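/- arXiv:2601.15242 — 4 statements merged into one kernel-verified Lean document; each statement's English description precedes it below -/
import Mathlib

section
/- (Ladyzhenskaya's inequality in dimension 2.) Let f : ℝ² → ℝ² be continuously differentiable with compact support. Then ‖f‖₄ ≤ 2^{1/4} ‖f‖₂^{1/2} ‖∇f‖₂^{1/2}. -/
open MeasureTheory

lemma aux1 (φ : ℝ → ℝ) (h : ContDiff ℝ 1 φ) (hs : HasCompactSupport φ) (b : ℝ) :
    φ b ≤ ∫ x, |deriv φ x| := by
  rw [← hs.integral_Iic_deriv_eq h b]
  have hi : Integrable (deriv φ) :=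
    (h.continuous_deriv le_rfl).integrable_of_hasCompactSupport hs.deriv
  calc _ ≤ ‖∫ x in Set.Iic b, deriv φ x‖ := Real.le_norm_self _
    _ ≤ ∫ x in Set.Iic b, ‖deriv φ x‖ := norm_integral_le_integral_norm _
    _ ≤ ∫ x, ‖deriv φ x‖ := setIntegral_le_integral hi.norm (Filter.Eventually.of_forall fun x => norm_nonneg _)

lemma aux2 (u A B : ℝ × ℝ → ℝ) (hu : Continuous u) (hus : HasCompactSupport u) (hu0 : ∀ p, 0 ≤ u p)
    (hA : Integrable A (volume.prod volume)) (hB : Integrable B (volume.prod volume))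
    (h1 : ∀ s t, u (s, t) ≤ ∫ x, A (x, t)) (h2 : ∀ s t, u (s, t) ≤ ∫ y, B (s, y)) :
    ∫ p, u p ^ 2 ≤ (∫ p, A p) * ∫ p, B p := by
  have e : (∫ p, A p) * ∫ p, B p =
      ∫ p : ℝ × ℝ, (∫ y, B (p.1, y)) * (∫ x, A (x, p.2)) := by
    rw [Measure.volume_eq_prod,
      integral_prod_mul (μ := volume) (ν := volume) (fun s => ∫ y, B (s, y)) (fun t => ∫ x, A (x, t)),
      integral_prod_symm _ hA, integral_prod _ hB, mul_comm]
  rw [e]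
  refine integral_mono ?_ ?_ ?_
  · refine Continuous.integrable_of_hasCompactSupport (by fun_prop) ?_
    exact hus.comp_left (g := fun x : ℝ => x ^ 2) (by simp)
  · exact Integrable.mul_prod hB.integral_prod_left hA.integral_prod_right
  · intro p
    simp only [pow_two]
    exact mul_le_mul (h2 p.1 p.2) (h1 p.1 p.2) (hu0 p) ((hu0 p).trans (h2 p.1 p.2))

lemma aux3 {V : Type*} [NormedAddCommGroup V] (F G : ℝ × ℝ → V)
    (hF : Continuous F) (hFs : HasCompactSupport F) (hG : Continuous G) (hGs : HasCompactSupport G) :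
    (∫ p, ‖F p‖ * ‖G p‖) ≤ √(∫ p, ‖F p‖ ^ 2) * √(∫ p, ‖G p‖ ^ 2) := by
  have := integral_mul_le_Lp_mul_Lq_of_nonneg (μ := (volume : Measure (ℝ × ℝ))) (p := 2) (q := 2)
    (f := fun p => ‖F p‖) (g := fun p => ‖G p‖) (by norm_num [Real.holderConjugate_iff])
    (Filter.Eventually.of_forall fun x => norm_nonneg _)
    (Filter.Eventually.of_forall fun x => norm_nonneg _)
    (by simpa using (hF.memLp_of_hasCompactSupport hFs).norm)
    (by simpa using (hG.memLp_of_hasCompactSupport hGs).norm)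
  simpa [Real.sqrt_eq_rpow] using this

lemma aux4 {V : Type*} [NormedAddCommGroup V] [InnerProductSpace ℝ V] (F : ℝ × ℝ → V)
    (hF : ContDiff ℝ 1 F) (hFs : HasCompactSupport F) :
    ∫ p, ‖F p‖ ^ 4 ≤ 2 * (∫ p, ‖F p‖ ^ 2) *
      ∫ p, (‖fderiv ℝ F p (1, 0)‖ ^ 2 + ‖fderiv ℝ F p (0, 1)‖ ^ 2) := by
  have hFc := hF.continuous
  have hD : ∀ v, Continuous fun p => fderiv ℝ F p v := fun v =>
    (hF.continuous_fderiv one_ne_zero).clm_apply continuous_const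
  have hDs : ∀ v, HasCompactSupport fun p => fderiv ℝ F p v := fun v =>
    (hFs.fderiv ℝ).comp_left (g := fun L : ℝ × ℝ →L[ℝ] V => L v) (by simp)
  have hAi : ∀ v, Integrable (fun p => 2 * (‖F p‖ * ‖fderiv ℝ F p v‖)) (volume : Measure (ℝ × ℝ)) := by
    intro v
    have := hD v
    refine Continuous.integrable_of_hasCompactSupport (by fun_prop) ?_
    exact (hFs.norm.mul_right).mul_left
  have key : ∀ (γ : ℝ → ℝ × ℝ) (v : ℝ × ℝ) (b : ℝ), (∀ x, HasDerivAt γ v x) → Topology.IsClosedEmbedding γ →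
      ContDiff ℝ 1 γ → ‖F (γ b)‖ ^ 2 ≤ ∫ x, 2 * (‖F (γ x)‖ * ‖fderiv ℝ F (γ x) v‖) := by
    intro γ v b hγ hγc hγd
    have hc : ContDiff ℝ 1 (fun x => F (γ x)) := hF.comp hγd
    have hcs : HasCompactSupport (fun x => F (γ x)) := hFs.comp_isClosedEmbedding hγc
    have hd : ∀ x, HasDerivAt (fun x => ‖F (γ x)‖ ^ 2) (2 * inner ℝ (F (γ x)) (fderiv ℝ F (γ x) v)) x := by
      intro x
      have h1 := ((hF.differentiable one_ne_zero (γ x)).hasFDerivAt).comp_hasDerivAt x (hγ x)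
      exact h1.norm_sq
    refine (aux1 (fun x => ‖F (γ x)‖ ^ 2) (hc.norm_sq ℝ)
      (hcs.comp_left (g := fun v : V => ‖v‖ ^ 2) (by simp)) b).trans ?_
    have hcont : Continuous fun x => fderiv ℝ F (γ x) v := (hD v).comp hγc.continuous
    have hcc := hc.continuous
    refine integral_mono_of_nonneg (Filter.Eventually.of_forall fun x => abs_nonneg _) ?_ ?_
    · refine Continuous.integrable_of_hasCompactSupport (by fun_prop) ?_
      exact (hcs.norm.mul_right).mul_left
    · refine Filter.Eventually.of_forall fun x => ?_
      simp only [(hd x).deriv, abs_mul, abs_two]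
      gcongr
      exact abs_real_inner_le_norm _ _
  have h := aux2 (fun p => ‖F p‖ ^ 2) _ _ (by fun_prop)
    (hFs.comp_left (g := fun v : V => ‖v‖ ^ 2) (by simp)) (fun p => by positivity)
    (hAi (1, 0)) (hAi (0, 1))
    (fun s t => key (fun x => (x, t)) (1, 0) s
      (fun x => (hasDerivAt_id x).prodMk (hasDerivAt_const x t))
      (Topology.IsClosedEmbedding.of_continuous_injective_isClosedMap (by fun_prop)
        (fun a b h => by simpa using h) (isClosedMap_prodMk_right t)) (by fun_prop))
    (fun s t => key (fun x => (s, x)) (0, 1) t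
      (fun x => (hasDerivAt_const x s).prodMk (hasDerivAt_id x))
      (Topology.IsClosedEmbedding.of_continuous_injective_isClosedMap (by fun_prop)
        (fun a b h => by simpa using h) (isClosedMap_prodMk_left s)) (by fun_prop))
  simp only [← pow_mul, integral_const_mul] at h
  norm_num at h
  refine h.trans ?_
  have hI : ∀ v, Integrable (fun p => ‖fderiv ℝ F p v‖ ^ 2) (volume : Measure (ℝ × ℝ)) := by
    intro v
    have := hD v
    refine Continuous.integrable_of_hasCompactSupport (by fun_prop) ?_
    exact (hDs v).comp_left (g := fun v : V => ‖v‖ ^ 2) (by simp)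
  rw [integral_add (hI _) (hI _)]
  have c1 := aux3 F _ hFc hFs (hD (1, 0)) (hDs _)
  have c2 := aux3 F _ hFc hFs (hD (0, 1)) (hDs _)
  have n1 : 0 ≤ ∫ p, ‖F p‖ * ‖fderiv ℝ F p (1, 0)‖ := integral_nonneg fun p => by positivity
  have n2 : 0 ≤ ∫ p, ‖F p‖ * ‖fderiv ℝ F p (0, 1)‖ := integral_nonneg fun p => by positivity
  have m := mul_le_mul c1 c2 n2 (by positivity)
  have s0 := Real.sq_sqrt (integral_nonneg (μ := (volume : Measure (ℝ × ℝ))) (f := fun p => ‖F p‖ ^ 2) fun p => by positivity)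
  have s1 := Real.sq_sqrt (integral_nonneg (μ := (volume : Measure (ℝ × ℝ))) (f := fun p => ‖fderiv ℝ F p (1, 0)‖ ^ 2) fun p => by positivity)
  have s2 := Real.sq_sqrt (integral_nonneg (μ := (volume : Measure (ℝ × ℝ))) (f := fun p => ‖fderiv ℝ F p (0, 1)‖ ^ 2) fun p => by positivity)
  set a := √(∫ p, ‖F p‖ ^ 2)
  set b := √(∫ p, ‖fderiv ℝ F p (1, 0)‖ ^ 2)
  set c := √(∫ p, ‖fderiv ℝ F p (0, 1)‖ ^ 2)
  rw [← s0, ← s1, ← s2]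
  nlinarith [mul_nonneg (sq_nonneg a) (sq_nonneg (b - c))]

/-- Ladyzhenskaya's inequality in dimension 2: for `f : ℝ² → ℝ²` continuously differentiable
with compact support, `‖f‖₄ ≤ 2^{1/4} ‖f‖₂^{1/2} ‖∇f‖₂^{1/2}`, where `‖∇f‖₂` is the `L²` norm
of the Hilbert–Schmidt (Frobenius) norm of the Fréchet derivative. -/
theorem ladyzhenskaya_dim2
    (f : EuclideanSpace ℝ (Fin 2) → EuclideanSpace ℝ (Fin 2))
    (hf : ContDiff ℝ 1 f) (hsupp : HasCompactSupport f) :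
    (∫ x, ‖f x‖ ^ 4) ^ ((1 : ℝ) / 4)
      ≤ (2 : ℝ) ^ ((1 : ℝ) / 4)
        * ((∫ x, ‖f x‖ ^ 2) ^ ((1 : ℝ) / 2)) ^ ((1 : ℝ) / 2)
        * ((∫ x, ∑ i, ∑ j, (fderiv ℝ f x (EuclideanSpace.single i 1) j) ^ 2)
            ^ ((1 : ℝ) / 2)) ^ ((1 : ℝ) / 2) := by
  let e : EuclideanSpace ℝ (Fin 2) ≃L[ℝ] ℝ × ℝ :=
    (EuclideanSpace.equiv (Fin 2) ℝ).trans (ContinuousLinearEquiv.finTwoArrow ℝ ℝ)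
  have he : MeasurePreserving e :=
    (volume_preserving_finTwoArrow ℝ).comp (EuclideanSpace.volume_preserving_symm_measurableEquiv_toLp (Fin 2))
  have hint : ∀ g : EuclideanSpace ℝ (Fin 2) → ℝ, ∫ p, g (e.symm p) = ∫ x, g x := by
    intro g
    rw [← he.integral_comp e.toHomeomorph.measurableEmbedding]
    simp
  have e1 : e.symm (1, 0) = EuclideanSpace.single 0 1 := by
    rw [e.symm_apply_eq]; simp [e]
  have e2 : e.symm (0, 1) = EuclideanSpace.single 1 1 := by
    rw [e.symm_apply_eq]; simp [e]
  have h := aux4 (fun p => f (e.symm p)) (hf.comp e.symm.contDiff)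
    (hsupp.comp_homeomorph e.symm.toHomeomorph)
  have hfd : ∀ p v, fderiv ℝ (fun p => f (e.symm p)) p v = fderiv ℝ f (e.symm p) (e.symm v) := by
    intro p v
    have := ((hf.differentiable one_ne_zero (e.symm p)).hasFDerivAt).comp p e.symm.hasFDerivAt
    have h2 := this.fderiv
    simp only [Function.comp_def] at h2
    rw [h2]; rfl
  simp only [hfd, e1, e2] at h
  rw [hint (fun x => ‖f x‖ ^ 4), hint (fun x => ‖f x‖ ^ 2),
    hint (fun x => ‖fderiv ℝ f x (EuclideanSpace.single 0 1)‖ ^ 2 + ‖fderiv ℝ f x (EuclideanSpace.single 1 1)‖ ^ 2)] at h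
  simp only [EuclideanSpace.norm_sq_eq (fderiv ℝ f _ _), Real.norm_eq_abs, sq_abs] at h
  have hN : 0 ≤ ∫ x, ‖f x‖ ^ 2 := integral_nonneg fun p => by positivity
  have hM : 0 ≤ ∫ x, ∑ i, ∑ j, (fderiv ℝ f x (EuclideanSpace.single i 1) j) ^ 2 :=
    integral_nonneg fun p => by positivity
  have h4 : 0 ≤ ∫ x, ‖f x‖ ^ 4 := integral_nonneg fun p => by positivity
  rw [← Real.rpow_mul hN, ← Real.rpow_mul hM]
  norm_num only
  rw [← Real.mul_rpow (by norm_num) hN, ← Real.mul_rpow (by positivity) hM]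
  refine Real.rpow_le_rpow h4 (h.trans_eq ?_) (by norm_num)
  simp only [Fin.sum_univ_two]
end

section
/- (Ladyzhenskaya's inequality in dimension 3.) Let f : ℝ³ → ℝ³ be continuously differentiable with compact support. Then ‖f‖₄ ≤ 2^{1/2} ‖f‖₂^{1/4} ‖∇f‖₂^{3/4}. -/
open MeasureTheory

theorem cs {α : Type*} [MeasurableSpace α] (μ : Measure α) (a b : α → ENNReal) (ha : Measurable a)
    (hb : Measurable b) : ∫⁻ x, a x * b x ∂μ ≤ (∫⁻ x, a x ^ 2 ∂μ) ^ (1/2:ℝ) * (∫⁻ x, b x ^ 2 ∂μ) ^ (1/2:ℝ) := by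
  have := ENNReal.lintegral_mul_le_Lp_mul_Lq μ Real.HolderConjugate.two_two ha.aemeasurable hb.aemeasurable
  simpa using this

theorem oneD {E : Type*} [NormedAddCommGroup E] [InnerProductSpace ℝ E] (φ φ' : ℝ → E)
    (h : ∀ t, HasDerivAt φ (φ' t) t) (hc : Continuous φ') (hs : HasCompactSupport φ) (t : ℝ) :
    ‖φ t‖ₑ ^ 2 ≤ 2 * ∫⁻ s, ‖φ s‖ₑ * ‖φ' s‖ₑ := by
  have hd : ∀ t, HasDerivAt (fun s => ‖φ s‖ ^ 2) (2 * inner ℝ (φ t) (φ' t)) t := fun t => (h t).norm_sq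
  have hφ : Continuous φ := continuous_iff_continuousAt.2 fun t => (h t).continuousAt
  have hC : ContDiff ℝ 1 (fun s => ‖φ s‖ ^ 2) := by
    rw [contDiff_one_iff_deriv]
    refine ⟨fun t => (hd t).differentiableAt, ?_⟩
    rw [show deriv (fun s => ‖φ s‖ ^ 2) = fun t => 2 * inner ℝ (φ t) (φ' t) from funext fun t => (hd t).deriv]
    fun_prop
  have hS : HasCompactSupport (fun s => ‖φ s‖ ^ 2) :=
    hs.comp_left (g := fun v : E => ‖v‖ ^ 2) (by simp)
  have h1 := hS.enorm_le_lintegral_Ici_deriv hC t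
  calc ‖φ t‖ₑ ^ 2 = ‖‖φ t‖ ^ 2‖ₑ := by simp [enorm_pow]
    _ ≤ _ := h1
    _ ≤ ∫⁻ s, ‖deriv (fun s => ‖φ s‖ ^ 2) s‖ₑ := setLIntegral_le_lintegral _ _
    _ ≤ ∫⁻ s, 2 * (‖φ s‖ₑ * ‖φ' s‖ₑ) := by
        apply lintegral_mono
        intro s
        simp only [(hd s).deriv]
        rw [enorm_mul]
        have e2 : ‖(2:ℝ)‖ₑ = 2 := by simp [Real.enorm_eq_ofReal]
        rw [e2]
        gcongr
        have := norm_inner_le_norm (𝕜 := ℝ) (φ s) (φ' s)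
        rw [← ofReal_norm, ← ofReal_norm, ← ofReal_norm, ← ENNReal.ofReal_mul (norm_nonneg _)]
        exact ENNReal.ofReal_le_ofReal this
    _ = _ := lintegral_const_mul' _ _ (by simp)

theorem twoD (a D1 D2 : ℝ × ℝ → ENNReal) (ha : Measurable a) (h1 : Measurable D1) (h2 : Measurable D2)
    (H1 : ∀ x y, a (x, y) ^ 2 ≤ 2 * ∫⁻ s, a (s, y) * D1 (s, y))
    (H2 : ∀ x y, a (x, y) ^ 2 ≤ 2 * ∫⁻ s, a (x, s) * D2 (x, s)) :
    ∫⁻ p, a p ^ 4 ≤ 4 * (∫⁻ p, a p ^ 2) * ((∫⁻ p, D1 p ^ 2) ^ (1/2:ℝ) * (∫⁻ p, D2 p ^ 2) ^ (1/2:ℝ)) := by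
  have m1 : Measurable fun p => a p * D1 p := ha.mul h1
  have m2 : Measurable fun p => a p * D2 p := ha.mul h2
  have c1 := cs volume a D1 ha h1
  have c2 := cs volume a D2 ha h2
  calc ∫⁻ p, a p ^ 4 ≤ ∫⁻ p : ℝ × ℝ, (2 * ∫⁻ s, a (p.1, s) * D2 (p.1, s)) * (2 * ∫⁻ s, a (s, p.2) * D1 (s, p.2)) := by
        apply lintegral_mono
        intro p
        calc a p ^ 4 = a (p.1, p.2) ^ 2 * a (p.1, p.2) ^ 2 := by rw [← pow_add]
          _ ≤ _ := mul_le_mul' (H2 _ _) (H1 _ _)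
    _ = (∫⁻ x, (2 * ∫⁻ s, a (x, s) * D2 (x, s))) * ∫⁻ y, (2 * ∫⁻ s, a (s, y) * D1 (s, y)) := by
        rw [Measure.volume_eq_prod]
        refine lintegral_prod_mul (f := fun x => (2 * ∫⁻ s, a (x, s) * D2 (x, s))) (g := fun y => (2 * ∫⁻ s, a (s, y) * D1 (s, y))) ?_ ?_
        · exact (m2.lintegral_prod_right'.const_mul 2).aemeasurable
        · exact (m1.lintegral_prod_left'.const_mul 2).aemeasurable
    _ = (2 * ∫⁻ p, a p * D2 p) * (2 * ∫⁻ p, a p * D1 p) := by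
        rw [lintegral_const_mul' _ _ (by simp), lintegral_const_mul' _ _ (by simp), Measure.volume_eq_prod, lintegral_prod _ m2.aemeasurable, lintegral_prod_symm _ m1.aemeasurable]
    _ ≤ (2 * ((∫⁻ p, a p ^ 2) ^ (1/2:ℝ) * (∫⁻ p, D2 p ^ 2) ^ (1/2:ℝ))) * (2 * ((∫⁻ p, a p ^ 2) ^ (1/2:ℝ) * (∫⁻ p, D1 p ^ 2) ^ (1/2:ℝ))) := by gcongr
    _ = 4 * ((∫⁻ p, a p ^ 2) ^ (1/2:ℝ) * (∫⁻ p, a p ^ 2) ^ (1/2:ℝ)) * ((∫⁻ p, D1 p ^ 2) ^ (1/2:ℝ) * (∫⁻ p, D2 p ^ 2) ^ (1/2:ℝ)) := by ring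
    _ = _ := by
        rw [← ENNReal.rpow_add_of_nonneg _ _ (by norm_num) (by norm_num)]
        norm_num

theorem threeD (a D1 D2 D3 : (ℝ × ℝ) × ℝ → ENNReal) (ha : Measurable a) (h1 : Measurable D1) (h2 : Measurable D2)
    (h3 : Measurable D3)
    (H1 : ∀ x y z, a ((x, y), z) ^ 2 ≤ 2 * ∫⁻ s, a ((s, y), z) * D1 ((s, y), z))
    (H2 : ∀ x y z, a ((x, y), z) ^ 2 ≤ 2 * ∫⁻ s, a ((x, s), z) * D2 ((x, s), z))
    (H3 : ∀ x y z, a ((x, y), z) ^ 2 ≤ 2 * ∫⁻ s, a ((x, y), s) * D3 ((x, y), s)) :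
    ∫⁻ p, a p ^ 4 ≤ 8 * ((∫⁻ p, a p ^ 2) ^ (1/2:ℝ) * (∫⁻ p, D1 p ^ 2) ^ (1/2:ℝ) * (∫⁻ p, D2 p ^ 2) ^ (1/2:ℝ)
      * (∫⁻ p, D3 p ^ 2) ^ (1/2:ℝ)) := by
  have m3 : Measurable fun p => a p * D3 p := ha.mul h3
  have q1 : Measurable fun p => D1 p ^ 2 := h1.pow_const 2
  have q2 : Measurable fun p => D2 p ^ 2 := h2.pow_const 2
  have N : ∀ z, ∫⁻ p, a (p, z) ^ 2 ≤ 2 * ∫⁻ p, a p * D3 p := by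
    intro z
    calc ∫⁻ p, a (p, z) ^ 2 ≤ ∫⁻ p : ℝ × ℝ, 2 * ∫⁻ s, a (p, s) * D3 (p, s) :=
          lintegral_mono fun p => H3 p.1 p.2 z
      _ = _ := by
        rw [lintegral_const_mul' _ _ (by simp)]
        conv_rhs => rw [Measure.volume_eq_prod, lintegral_prod _ m3.aemeasurable]
  have c3 := cs volume a D3 ha h3
  have c12 := cs volume (fun z => (∫⁻ p, D1 (p, z) ^ 2) ^ (1/2:ℝ)) (fun z => (∫⁻ p, D2 (p, z) ^ 2) ^ (1/2:ℝ))
    (q1.lintegral_prod_left'.pow_const _) (q2.lintegral_prod_left'.pow_const _)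
  have e : ∀ t : ENNReal, (t ^ (1/2:ℝ)) ^ 2 = t := by
    intro t
    rw [← ENNReal.rpow_natCast, ← ENNReal.rpow_mul]; norm_num
  simp only [e] at c12
  have i1 : ∫⁻ z, ∫⁻ p, D1 (p, z) ^ 2 = ∫⁻ p, D1 p ^ 2 := by
    conv_rhs => rw [Measure.volume_eq_prod, lintegral_prod_symm _ q1.aemeasurable]
  have i2 : ∫⁻ z, ∫⁻ p, D2 (p, z) ^ 2 = ∫⁻ p, D2 p ^ 2 := by
    conv_rhs => rw [Measure.volume_eq_prod, lintegral_prod_symm _ q2.aemeasurable]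
  rw [i1, i2] at c12
  calc ∫⁻ p, a p ^ 4 = ∫⁻ z, ∫⁻ p, a (p, z) ^ 4 := by
        conv_lhs => rw [Measure.volume_eq_prod, lintegral_prod_symm _ (ha.pow_const 4).aemeasurable]
    _ ≤ ∫⁻ z, 4 * (2 * ∫⁻ p, a p * D3 p) * ((∫⁻ p, D1 (p, z) ^ 2) ^ (1/2:ℝ) * (∫⁻ p, D2 (p, z) ^ 2) ^ (1/2:ℝ)) := by
        apply lintegral_mono
        intro z
        refine (twoD (fun p => a (p, z)) (fun p => D1 (p, z)) (fun p => D2 (p, z)) (by fun_prop) (by fun_prop) (by fun_prop)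
          (fun x y => H1 x y z) (fun x y => H2 x y z)).trans ?_
        exact mul_le_mul_left (mul_le_mul_right (N z) 4) _
    _ = 4 * (2 * ∫⁻ p, a p * D3 p) * ∫⁻ z, ((∫⁻ p, D1 (p, z) ^ 2) ^ (1/2:ℝ) * (∫⁻ p, D2 (p, z) ^ 2) ^ (1/2:ℝ)) := by
        rw [lintegral_const_mul]
        exact (q1.lintegral_prod_left'.pow_const _).mul (q2.lintegral_prod_left'.pow_const _)
    _ ≤ 4 * (2 * _) * _ := mul_le_mul' (mul_le_mul_right (mul_le_mul_right c3 2) 4) c12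
    _ = _ := by ring

def ee (p : (ℝ × ℝ) × ℝ) : EuclideanSpace ℝ (Fin 3) := !₂[p.1.1, p.1.2, p.2]

theorem ee_mp : MeasurePreserving ee volume volume := by
  have A := (volume_preserving_finTwoArrow ℝ).symm
  have B := (volume_preserving_piFinSuccAbove (fun _ : Fin 3 => ℝ) 2).symm
  have C := PiLp.volume_preserving_toLp (Fin 3)
  have S : MeasurePreserving (Prod.swap : (ℝ × ℝ) × ℝ → ℝ × (ℝ × ℝ)) volume volume := Measure.measurePreserving_swap
  have T := C.comp (B.comp (((MeasurePreserving.id (volume : Measure ℝ)).prod A).comp S))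
  have hEq : ee = (WithLp.toLp 2 ∘
      (MeasurableEquiv.piFinSuccAbove (fun _ : Fin 3 => ℝ) 2).symm ∘
        Prod.map id (MeasurableEquiv.finTwoArrow (α := ℝ)).symm ∘ Prod.swap) := by
    funext p
    ext i
    fin_cases i <;> rfl
  rw [hEq]
  exact T

theorem slice (f : EuclideanSpace ℝ (Fin 3) → EuclideanSpace ℝ (Fin 3))
    (hf : ContDiff ℝ 1 f) (hsupp : HasCompactSupport f) (i : Fin 3) (v : EuclideanSpace ℝ (Fin 3)) (t : ℝ) :
    ‖f (v + t • EuclideanSpace.single i 1)‖ₑ ^ 2 ≤ 2 * ∫⁻ s : ℝ, ‖f (v + s • EuclideanSpace.single i 1)‖ₑ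
      * ‖fderiv ℝ f (v + s • EuclideanSpace.single i 1) (EuclideanSpace.single i 1)‖ₑ := by
  have hfd := hf.continuous_fderiv one_ne_zero
  have hd := hf.differentiable one_ne_zero
  refine oneD (fun s => f (v + s • EuclideanSpace.single i 1))
    (fun s => fderiv ℝ f (v + s • EuclideanSpace.single i 1) (EuclideanSpace.single i 1)) ?_ ?_ ?_ t
  · intro s
    have h1 : HasDerivAt (fun s : ℝ => v + s • (EuclideanSpace.single i 1 : EuclideanSpace ℝ (Fin 3)))
        (EuclideanSpace.single i 1) s := by
      simpa using ((hasDerivAt_id s).smul_const (EuclideanSpace.single i 1 : EuclideanSpace ℝ (Fin 3))).const_add v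
    exact (hd _).hasFDerivAt.comp_hasDerivAt s h1
  · fun_prop
  · have hne : (EuclideanSpace.single i 1 : EuclideanSpace ℝ (Fin 3)) ≠ 0 := by simp
    exact hsupp.comp_isClosedEmbedding
      ((Homeomorph.addLeft v).isClosedEmbedding.comp (isClosedEmbedding_smul_left hne))

theorem key (f : EuclideanSpace ℝ (Fin 3) → EuclideanSpace ℝ (Fin 3))
    (hf : ContDiff ℝ 1 f) (hsupp : HasCompactSupport f) :
    ∫⁻ x, ‖f x‖ₑ ^ 4 ≤ 8 * ((∫⁻ x, ‖f x‖ₑ ^ 2) ^ (1/2:ℝ)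
      * (∫⁻ x, ‖fderiv ℝ f x (EuclideanSpace.single 0 1)‖ₑ ^ 2) ^ (1/2:ℝ)
      * (∫⁻ x, ‖fderiv ℝ f x (EuclideanSpace.single 1 1)‖ₑ ^ 2) ^ (1/2:ℝ)
      * (∫⁻ x, ‖fderiv ℝ f x (EuclideanSpace.single 2 1)‖ₑ ^ 2) ^ (1/2:ℝ)) := by
  have hfd := hf.continuous_fderiv one_ne_zero
  have hc := hf.continuous
  have hm := ee_mp.measurable
  have ma : Measurable fun x => ‖f x‖ₑ := by fun_prop
  have mD : ∀ i : Fin 3, Measurable fun x => ‖fderiv ℝ f x (EuclideanSpace.single i 1)‖ₑ := fun i =>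
    (show Continuous fun x => ‖fderiv ℝ f x (EuclideanSpace.single i 1)‖ₑ by fun_prop).measurable
  rw [← ee_mp.lintegral_comp (ma.pow_const 4), ← ee_mp.lintegral_comp (ma.pow_const 2),
    ← ee_mp.lintegral_comp ((mD 0).pow_const 2), ← ee_mp.lintegral_comp ((mD 1).pow_const 2),
    ← ee_mp.lintegral_comp ((mD 2).pow_const 2)]
  have e0 : ∀ x y z : ℝ, ee ((x, y), z) = ee ((0, y), z) + x • EuclideanSpace.single 0 1 := by
    intro x y z; ext i; fin_cases i <;> simp [ee]
  have e1 : ∀ x y z : ℝ, ee ((x, y), z) = ee ((x, 0), z) + y • EuclideanSpace.single 1 1 := by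
    intro x y z; ext i; fin_cases i <;> simp [ee]
  have e2 : ∀ x y z : ℝ, ee ((x, y), z) = ee ((x, y), 0) + z • EuclideanSpace.single 2 1 := by
    intro x y z; ext i; fin_cases i <;> simp [ee]
  refine threeD (fun p => ‖f (ee p)‖ₑ) (fun p => ‖fderiv ℝ f (ee p) (EuclideanSpace.single 0 1)‖ₑ)
    (fun p => ‖fderiv ℝ f (ee p) (EuclideanSpace.single 1 1)‖ₑ)
    (fun p => ‖fderiv ℝ f (ee p) (EuclideanSpace.single 2 1)‖ₑ)
    (ma.comp hm) ((mD 0).comp hm) ((mD 1).comp hm) ((mD 2).comp hm) ?_ ?_ ?_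
  · intro x y z
    have := slice f hf hsupp 0 (ee ((0, y), z)) x
    simpa only [← e0] using this
  · intro x y z
    have := slice f hf hsupp 1 (ee ((x, 0), z)) y
    simpa only [← e1] using this
  · intro x y z
    have := slice f hf hsupp 2 (ee ((x, y), 0)) z
    simpa only [← e2] using this

theorem conv (g : EuclideanSpace ℝ (Fin 3) → EuclideanSpace ℝ (Fin 3)) (hg : Continuous g)
    (hs : HasCompactSupport g) (n : ℕ) (hn : n ≠ 0) :
    Integrable (fun x => ‖g x‖ ^ n) ∧ ∫⁻ x, ‖g x‖ₑ ^ n = ENNReal.ofReal (∫ x, ‖g x‖ ^ n) := by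
  have hi : Integrable (fun x => ‖g x‖ ^ n) := by
    apply Continuous.integrable_of_hasCompactSupport (by fun_prop)
    exact hs.comp_left (g := fun v : EuclideanSpace ℝ (Fin 3) => ‖v‖ ^ n) (by simp [hn])
  refine ⟨hi, ?_⟩
  rw [ofReal_integral_eq_lintegral_ofReal hi (Filter.Eventually.of_forall fun x => by positivity)]
  congr 1; funext x
  rw [ENNReal.ofReal_pow (norm_nonneg _), ofReal_norm]

theorem ladyzhenskaya_dim3
    (f : EuclideanSpace ℝ (Fin 3) → EuclideanSpace ℝ (Fin 3))
    (hf : ContDiff ℝ 1 f) (hsupp : HasCompactSupport f) :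
    (∫ x, ‖f x‖ ^ 4) ^ ((1 : ℝ) / 4)
      ≤ (2 : ℝ) ^ ((1 : ℝ) / 2)
        * ((∫ x, ‖f x‖ ^ 2) ^ ((1 : ℝ) / 2)) ^ ((1 : ℝ) / 4)
        * ((∫ x, ∑ i, ∑ j, (fderiv ℝ f x (EuclideanSpace.single i 1) j) ^ 2)
            ^ ((1 : ℝ) / 2)) ^ ((3 : ℝ) / 4) := by
  have K := key f hf hsupp
  have hfd := hf.continuous_fderiv one_ne_zero
  have hs : ∀ i : Fin 3, HasCompactSupport fun x => fderiv ℝ f x (EuclideanSpace.single i 1) := fun i =>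
    hsupp.fderiv_apply ℝ _
  have hD := fun i : Fin 3 => conv (fun x => fderiv ℝ f x (EuclideanSpace.single i 1)) (by fun_prop) (hs i) 2 two_ne_zero
  have hJ : ∫ x, ∑ i, ∑ j, (fderiv ℝ f x (EuclideanSpace.single i 1) j) ^ 2
      = ∑ i, ∫ x, ‖fderiv ℝ f x (EuclideanSpace.single i 1)‖ ^ 2 := by
    rw [← integral_finsetSum _ fun i _ => (hD i).1]
    congr 1; funext x
    refine Finset.sum_congr rfl fun i _ => ?_
    rw [EuclideanSpace.norm_sq_eq]
    simp
  rw [(conv f hf.continuous hsupp 4 (by norm_num)).2, (conv f hf.continuous hsupp 2 (by norm_num)).2,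
    (hD 0).2, (hD 1).2, (hD 2).2] at K
  rw [hJ, Fin.sum_univ_three]
  have p4 : 0 ≤ ∫ x, ‖f x‖ ^ 4 := integral_nonneg fun x => by positivity
  have p2 : 0 ≤ ∫ x, ‖f x‖ ^ 2 := integral_nonneg fun x => by positivity
  have pD : ∀ i : Fin 3, 0 ≤ ∫ x, ‖fderiv ℝ f x (EuclideanSpace.single i 1)‖ ^ 2 :=
    fun i => integral_nonneg fun x => by positivity
  have pa := pD 0
  have pb := pD 1
  have pc := pD 2
  generalize (∫ x, ‖f x‖ ^ 4) = A at *
  generalize (∫ x, ‖f x‖ ^ 2) = B at *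
  generalize (∫ x, ‖fderiv ℝ f x (EuclideanSpace.single 0 1)‖ ^ 2) = a at *
  generalize (∫ x, ‖fderiv ℝ f x (EuclideanSpace.single 1 1)‖ ^ 2) = b at *
  generalize (∫ x, ‖fderiv ℝ f x (EuclideanSpace.single 2 1)‖ ^ 2) = c at *
  clear hJ hD pD
  rw [ENNReal.ofReal_rpow_of_nonneg p2 (by norm_num), ENNReal.ofReal_rpow_of_nonneg pa (by norm_num),
    ENNReal.ofReal_rpow_of_nonneg pb (by norm_num), ENNReal.ofReal_rpow_of_nonneg pc (by norm_num),
    ← ENNReal.ofReal_mul (by positivity), ← ENNReal.ofReal_mul (by positivity),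
    ← ENNReal.ofReal_mul (by positivity), show (8 : ENNReal) = ENNReal.ofReal 8 by simp,
    ← ENNReal.ofReal_mul (by positivity), ENNReal.ofReal_le_ofReal_iff (by positivity)] at K
  simp only [← Real.sqrt_eq_rpow] at *
  have hab : √a * √b ≤ (a + b + c) / 2 := by
    nlinarith [sq_nonneg (√a - √b), Real.sq_sqrt pa, Real.sq_sqrt pb]
  have hcc : √c ≤ √(a + b + c) := Real.sqrt_le_sqrt (by linarith)
  have hSq : √(a + b + c) ^ 2 = a + b + c := Real.sq_sqrt (by linarith)
  have K2 : A ≤ 4 * √B * √(a + b + c) ^ 3 := by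
    have h1 := mul_le_mul hab hcc (by positivity) (by positivity)
    have h2 := mul_le_mul_of_nonneg_left h1 (Real.sqrt_nonneg B)
    calc A ≤ _ := K
      _ = 8 * (√B * (√a * √b * √c)) := by ring
      _ ≤ 8 * (√B * ((a + b + c) / 2 * √(a + b + c))) := by linarith
      _ = 4 * √B * (√(a + b + c) ^ 2 * √(a + b + c)) := by rw [hSq]; ring
      _ = _ := by ring
  calc A ^ ((1:ℝ)/4) ≤ (4 * √B * √(a + b + c) ^ 3) ^ ((1:ℝ)/4) := by gcongr
    _ = _ := by
      rw [Real.mul_rpow (by positivity) (by positivity), Real.mul_rpow (by positivity) (by positivity)]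
      congr 1
      · congr 1
        rw [show (4:ℝ) = 2 ^ (2:ℝ) by norm_num, ← Real.rpow_mul (by norm_num), Real.sqrt_eq_rpow]
        norm_num
      · rw [← Real.rpow_natCast, ← Real.rpow_mul (by positivity)]
        norm_num
end

section
/- Let p : ℝ³ → ℝ³ be continuously differentiable with compact support and divergence-free (div p ≡ 0), and let q, r : ℝ³ → ℝ³ be continuously differentiable. Then the trilinear convection form is skew-symmetric in its last two arguments: ∫_{ℝ³} ⟪((p·∇)q)(x), r(x)⟫ dx = − ∫_{ℝ³} ⟪((p·∇)r)(x), q(x)⟫ dx. -/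
open MeasureTheory

/-- For a divergence-free `C¹` vector field `p : ℝ³ → ℝ³` with compact support and any
`C¹` vector fields `q, r : ℝ³ → ℝ³`, the trilinear convection form is skew-symmetric in its
last two arguments: `∫ ⟪(p·∇)q, r⟫ = − ∫ ⟪(p·∇)r, q⟫`, where `((p·∇)q)_j = Σᵢ pᵢ ∂ᵢ q_j`. -/
theorem convection_trilinear_skew_symmetric
    (p q r : EuclideanSpace ℝ (Fin 3) → EuclideanSpace ℝ (Fin 3))
    (hp : ContDiff ℝ 1 p) (hps : HasCompactSupport p)
    (hdiv : ∀ x, ∑ i, fderiv ℝ p x (EuclideanSpace.single i 1) i = 0)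
    (hq : ContDiff ℝ 1 q) (hr : ContDiff ℝ 1 r) :
    ∫ x, ∑ j, (∑ i, p x i * fderiv ℝ q x (EuclideanSpace.single i 1) j) * r x j
      = - ∫ x, ∑ j, (∑ i, p x i * fderiv ℝ r x (EuclideanSpace.single i 1) j) * q x j := by
  have hpi : ∀ i, ContDiff ℝ 1 (fun x => p x i) := fun i => (contDiff_euclidean.1 hp) i
  have hqi : ∀ i, ContDiff ℝ 1 (fun x => q x i) := fun i => (contDiff_euclidean.1 hq) i
  have hri : ∀ i, ContDiff ℝ 1 (fun x => r x i) := fun i => (contDiff_euclidean.1 hr) i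
  have hcomp : ∀ (u : EuclideanSpace ℝ (Fin 3) → EuclideanSpace ℝ (Fin 3)), ContDiff ℝ 1 u →
      ∀ x v j, fderiv ℝ (fun y => u y j) x v = fderiv ℝ u x v j := by
    intro u hu x v j
    have h := ((EuclideanSpace.proj j : EuclideanSpace ℝ (Fin 3) →L[ℝ] ℝ).hasFDerivAt).comp x
      ((hu.differentiable one_ne_zero x).hasFDerivAt)
    have h2 : HasFDerivAt (fun y => u y j) _ x := h
    rw [h2.fderiv]
    rfl
  have hcd : ∀ (u : EuclideanSpace ℝ (Fin 3) → EuclideanSpace ℝ (Fin 3)), ContDiff ℝ 1 u →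
      ∀ v j, Continuous (fun x => fderiv ℝ u x v j) := by
    intro u hu v j
    have h := (contDiff_euclidean.1 hu) j
    have h2 := (h.continuous_fderiv one_ne_zero).clm_apply (continuous_const (y := v))
    exact h2.congr (fun x => hcomp u hu x v j)
  set s : EuclideanSpace ℝ (Fin 3) → ℝ := fun x => ∑ j, q x j * r x j with hs
  have hsC : ContDiff ℝ 1 s := ContDiff.sum fun j _ => (hqi j).mul (hri j)
  have hsd : ∀ x v, fderiv ℝ s x v
      = ∑ j, (q x j * fderiv ℝ r x v j + r x j * fderiv ℝ q x v j) := by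
    intro x v
    have h : HasFDerivAt s (∑ j, (q x j • fderiv ℝ (fun y => r y j) x
        + r x j • fderiv ℝ (fun y => q y j) x)) x :=
      HasFDerivAt.fun_sum fun j _ => (((hqi j).differentiable one_ne_zero x).hasFDerivAt).mul
        (((hri j).differentiable one_ne_zero x).hasFDerivAt)
    rw [h.fderiv]
    simp [hcomp q hq, hcomp r hr]
  have hpc : ∀ i, HasCompactSupport (fun x => p x i) := fun i =>
    hps.comp_left (g := fun y : EuclideanSpace ℝ (Fin 3) => y i) rfl
  have hsdc : ∀ v, Continuous (fun x => fderiv ℝ s x v) := fun v =>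
    (hsC.continuous_fderiv one_ne_zero).clm_apply continuous_const
  have hpdc : ∀ i v, Continuous (fun x => fderiv ℝ (fun y => p y i) x v) := fun i v =>
    ((hpi i).continuous_fderiv one_ne_zero).clm_apply continuous_const
  have I1 : ∀ i v, Integrable (fun x => fderiv ℝ (fun y => p y i) x v * s x) := fun i v =>
    ((hpdc i v).mul hsC.continuous).integrable_of_hasCompactSupport
      (((hpc i).fderiv_apply (𝕜 := ℝ) v).mul_right)
  have I2 : ∀ i v, Integrable (fun x => p x i * fderiv ℝ s x v) := fun i v =>
    ((hpi i).continuous.mul (hsdc v)).integrable_of_hasCompactSupport (hpc i).mul_right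
  have I3 : ∀ i, Integrable (fun x => p x i * s x) := fun i =>
    ((hpi i).continuous.mul hsC.continuous).integrable_of_hasCompactSupport (hpc i).mul_right
  have key : ∀ i v, ∫ x, p x i * fderiv ℝ s x v
      = - ∫ x, fderiv ℝ (fun y => p y i) x v * s x := fun i v =>
    integral_mul_fderiv_eq_neg_fderiv_mul_of_integrable (I1 i v) (I2 i v) (I3 i)
      (fun x _ => (hpi i).differentiable one_ne_zero x) (fun x _ => hsC.differentiable one_ne_zero x)
  have J : ∀ (u w : EuclideanSpace ℝ (Fin 3) → EuclideanSpace ℝ (Fin 3)), ContDiff ℝ 1 u →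
      ContDiff ℝ 1 w → Integrable (fun x =>
        ∑ j, (∑ i, p x i * fderiv ℝ u x (EuclideanSpace.single i 1) j) * w x j) := by
    intro u w hu hw
    refine integrable_finsetSum _ fun j _ => ?_
    simp only [Finset.sum_mul, mul_assoc]
    refine integrable_finsetSum _ fun i _ => ?_
    exact ((hpi i).continuous.mul ((hcd u hu _ j).mul
      ((contDiff_euclidean.1 hw) j).continuous)).integrable_of_hasCompactSupport (hpc i).mul_right
  rw [eq_neg_iff_add_eq_zero, ← integral_add (J q r hq hr) (J r q hr hq)]
  have e1 : ∀ x, (∑ j, (∑ i, p x i * fderiv ℝ q x (EuclideanSpace.single i 1) j) * r x j)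
      + (∑ j, (∑ i, p x i * fderiv ℝ r x (EuclideanSpace.single i 1) j) * q x j)
      = ∑ i, p x i * fderiv ℝ s x (EuclideanSpace.single i 1) := by
    intro x
    simp only [hsd, Fin.sum_univ_three]
    ring
  simp only [e1]
  rw [integral_finsetSum _ fun i _ => I2 i _]
  simp only [key]
  rw [Finset.sum_neg_distrib, ← integral_finsetSum _ fun i _ => I1 i _]
  simp only [← Finset.sum_mul, hcomp p hp, hdiv]
  simp
end

section
/- Let p : ℝ³ → ℝ³ be continuously differentiable with compact support, and let q : ℝ³ → ℝ³ be differentiable with ‖∇q‖₂ < ∞. Then |∫_{ℝ³} ⟪((p·∇)q)(x), p(x)⟫ dx| ≤ 2 ‖p‖₂^{1/2} ‖∇p‖₂^{3/2} ‖∇q‖₂. (This combines the Hölder bound |b(p,q,p)| ≤ ‖p‖₄²‖∇q‖₂ with Ladyzhenskaya's inequality in three dimensions, and shows that the convection operator B maps V into V′ with ‖B(p)‖_{V′} ≤ C‖p‖_V².) -/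
open MeasureTheory

open scoped ENNReal

lemma lad_half {f : ℝ → ℝ} (hf : ContDiff ℝ 1 f) (h2 : HasCompactSupport f) (x : ℝ) :
    2 * ‖f x‖ₑ ≤ ∫⁻ y, ‖deriv f y‖ₑ := by
  have h1 : ‖f x‖ₑ ≤ ∫⁻ y in Set.Iic x, ‖deriv f y‖ₑ :=
    HasCompactSupport.enorm_le_lintegral_Ici_deriv hf h2 x
  have h3 : ‖f x‖ₑ ≤ ∫⁻ y in (Set.Iic x)ᶜ, ‖deriv f y‖ₑ := by
    rw [Set.compl_Iic, ← enorm_neg, ← HasCompactSupport.integral_Ioi_deriv_eq hf h2 x]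
    exact enorm_integral_le_lintegral_enorm _
  rw [← lintegral_add_compl _ (measurableSet_Iic (a := x)), two_mul]
  exact add_le_add h1 h3

abbrev LadE := EuclideanSpace ℝ (Fin 3)

noncomputable def ladGS (p : LadE → LadE) (x : LadE) : ℝ :=
  ∑ i, ∑ j, (fderiv ℝ p x (EuclideanSpace.single i 1) j) ^ 2

lemma ladGS_nonneg (p : LadE → LadE) (x : LadE) : 0 ≤ ladGS p x := by
  unfold ladGS; positivity

lemma lad_norm_le (p : LadE → LadE) (x : LadE) (i : Fin 3) :
    ‖fderiv ℝ p x (EuclideanSpace.single i 1)‖ ≤ √(ladGS p x) := by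
  rw [EuclideanSpace.norm_eq]
  apply Real.sqrt_le_sqrt
  unfold ladGS
  simp only [Real.norm_eq_abs, sq_abs]
  exact Finset.single_le_sum
    (f := fun i => ∑ j, (fderiv ℝ p x (EuclideanSpace.single i 1) j) ^ 2)
    (fun i _ => by positivity) (Finset.mem_univ i)

lemma ladGS_meas (p : LadE → LadE) : Measurable (ladGS p) := by
  unfold ladGS
  refine Finset.measurable_sum _ fun i _ => Finset.measurable_sum _ fun j _ => ?_
  have h := measurable_fderiv_apply_const ℝ p (EuclideanSpace.single i (1:ℝ))
  have h2 : Measurable fun y : LadE => y j := by fun_prop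
  exact (h2.comp h).pow_const 2

noncomputable def ladF (p : LadE → LadE) (x : LadE) : ℝ≥0∞ :=
  ENNReal.ofReal (4 / 3 * ‖p x‖ ^ (5 / 3 : ℝ) * √(ladGS p x))

lemma ladF_meas (p : LadE → LadE) (hp : ContDiff ℝ 1 p) : Measurable (ladF p) := by
  unfold ladF
  have := ladGS_meas p
  have := hp.continuous.measurable
  fun_prop

lemma lad_line (p : LadE → LadE) (hp : ContDiff ℝ 1 p) (hps : HasCompactSupport p)
    (y : Fin 3 → ℝ) (i : Fin 3) :
    ‖p (WithLp.toLp 2 y)‖ₑ ^ (8 / 3 : ℝ) ≤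
      ∫⁻ t, ladF p (WithLp.toLp 2 (Function.update y i t)) := by
  let g : ℝ → LadE := fun t => p (WithLp.toLp 2 (Function.update y i t))
  have hu : ∀ t, HasDerivAt (fun t => (WithLp.toLp 2 (Function.update y i t) : LadE))
      (EuclideanSpace.single i 1) t := by
    intro t
    have := (PiLp.continuousLinearEquiv 2 ℝ (fun _ : Fin 3 => ℝ)).symm.hasFDerivAt.comp_hasDerivAt t
      (hasDerivAt_update y i t)
    exact this
  have hgd : ∀ t, HasDerivAt g (fderiv ℝ p (WithLp.toLp 2 (Function.update y i t))
      (EuclideanSpace.single i 1)) t := by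
    intro t
    exact ((hp.differentiable one_ne_zero) _).hasFDerivAt.comp_hasDerivAt t (hu t)
  have hgc : ContDiff ℝ 1 g := by
    refine hp.comp ?_
    refine (PiLp.continuousLinearEquiv 2 ℝ (fun _ : Fin 3 => ℝ)).symm.contDiff.comp ?_
    convert! contDiff_update 1 y i
  have hgs : HasCompactSupport g := by
    refine (hps.comp_homeomorph
      (PiLp.continuousLinearEquiv 2 ℝ (fun _ : Fin 3 => ℝ)).symm.toHomeomorph).comp_isClosedEmbedding
       (isClosedEmbedding_update y i)
  have h1 : (1:ℝ) < 8 / 3 := by norm_num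
  have key := lad_half (f := fun t => ‖g t‖ ^ (8 / 3 : ℝ)) (hgc.norm_rpow h1)
    (hgs.norm.comp_left (g := fun s : ℝ => s ^ (8 / 3 : ℝ)) (by simp)) (y i)
  have hd : ∀ t, ‖deriv (fun t => ‖g t‖ ^ (8 / 3 : ℝ)) t‖ₑ ≤
      2 * ladF p (WithLp.toLp 2 (Function.update y i t)) := by
    intro t
    have h := norm_fderiv_norm_rpow_le (hgc.differentiable one_ne_zero) (x := t) h1
    rw [← norm_deriv_eq_norm_fderiv, ← norm_deriv_eq_norm_fderiv, (hgd t).deriv] at h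
    have h' := h.trans (mul_le_mul_of_nonneg_left (lad_norm_le p _ i) (by positivity))
    have e2 : ∀ z : ℝ≥0∞, 2 * z = ENNReal.ofReal 2 * z := by simp
    rw [ladF, e2, ← ENNReal.ofReal_mul (by norm_num), ← ofReal_norm]
    apply ENNReal.ofReal_le_ofReal
    refine h'.trans (le_of_eq ?_)
    norm_num
    ring
  have h3 := key.trans (lintegral_mono hd)
  rw [lintegral_const_mul' _ _ (by simp)] at h3
  have h4 := (ENNReal.mul_le_mul_iff_right (by simp) (by simp)).1 h3
  refine le_trans (le_of_eq ?_) h4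
  simp only [g, Function.update_eq_self]
  rw [← ofReal_norm, ← ofReal_norm, Real.norm_of_nonneg (by positivity),
    ENNReal.ofReal_rpow_of_nonneg (by positivity) (by positivity)]

lemma lad_grid (p : LadE → LadE) (hp : ContDiff ℝ 1 p) (hps : HasCompactSupport p) :
    ∫⁻ x, ‖p x‖ₑ ^ (4 : ℝ) ≤ (∫⁻ x, ladF p x) ^ (3 / 2 : ℝ) := by
  have hF := ladF_meas p hp
  rw [← (PiLp.volume_preserving_toLp (Fin 3)).lintegral_comp hF,
    ← (PiLp.volume_preserving_toLp (Fin 3)).lintegral_comp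
      (by have := hp.continuous.measurable; fun_prop)]
  have hc : Real.HolderConjugate (Fintype.card (Fin 3) : ℝ) (3/2) := by
    rw [Real.holderConjugate_iff]; norm_num
  have := lintegral_prod_lintegral_pow_le (fun _ : Fin 3 => (volume : Measure ℝ)) hc
    (f := fun y => ladF p (WithLp.toLp 2 y)) (by fun_prop)
  refine le_trans (lintegral_mono fun y => ?_) this
  have e : ‖p (WithLp.toLp 2 y)‖ₑ ^ (4 : ℝ) =
      ∏ i : Fin 3, (‖p (WithLp.toLp 2 y)‖ₑ ^ (8 / 3 : ℝ)) ^ ((1 : ℝ) / ((Fintype.card (Fin 3) : ℝ) - 1)) := by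
    rw [Finset.prod_const, ← ENNReal.rpow_mul, ← ENNReal.rpow_mul_natCast]
    norm_num
  simp only [e]
  gcongr with i
  · norm_num
  · exact lad_line p hp hps y i

lemma lad_holder (p : LadE → LadE) (hp : ContDiff ℝ 1 p) :
    ∫⁻ x, ladF p x ≤ ENNReal.ofReal (4 / 3) *
      (((∫⁻ x, ‖p x‖ₑ ^ (2 : ℝ)) ^ (1 / 3 : ℝ) * (∫⁻ x, ‖p x‖ₑ ^ (4 : ℝ)) ^ (2 / 3 : ℝ)) ^ (1 / 2 : ℝ)
        * (∫⁻ x, ENNReal.ofReal (ladGS p x)) ^ (1 / 2 : ℝ)) := by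
  have hm := hp.continuous.measurable
  have hg := ladGS_meas p
  have h1 : ∫⁻ x, ‖p x‖ₑ ^ (10 / 3 : ℝ) ≤
      (∫⁻ x, ‖p x‖ₑ ^ (2 : ℝ)) ^ (1 / 3 : ℝ) * (∫⁻ x, ‖p x‖ₑ ^ (4 : ℝ)) ^ (2 / 3 : ℝ) := by
    refine le_trans (le_of_eq ?_) (ENNReal.lintegral_mul_norm_pow_le
      (f := fun x => ‖p x‖ₑ ^ (2 : ℝ)) (g := fun x => ‖p x‖ₑ ^ (4 : ℝ))
      (by fun_prop) (by fun_prop) (p := 1 / 3) (q := 2 / 3) (by norm_num) (by norm_num) (by norm_num))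
    congr with x
    rw [← ENNReal.rpow_mul, ← ENNReal.rpow_mul, ← ENNReal.rpow_add_of_nonneg _ _ (by norm_num) (by norm_num)]
    norm_num
  have h2 := ENNReal.lintegral_mul_norm_pow_le (μ := (volume : Measure LadE))
      (f := fun x => ‖p x‖ₑ ^ (10 / 3 : ℝ)) (g := fun x => ENNReal.ofReal (ladGS p x))
      (by fun_prop) (by fun_prop) (p := 1 / 2) (q := 1 / 2) (by norm_num) (by norm_num) (by norm_num)
  have e : ∀ x, ladF p x = ENNReal.ofReal (4 / 3) *
      ((‖p x‖ₑ ^ (10 / 3 : ℝ)) ^ (1 / 2 : ℝ) * ENNReal.ofReal (ladGS p x) ^ (1 / 2 : ℝ)) := by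
    intro x
    rw [ladF, ENNReal.ofReal_mul (by positivity), ENNReal.ofReal_mul (by positivity), mul_assoc,
      ← ENNReal.rpow_mul, Real.sqrt_eq_rpow, ENNReal.ofReal_rpow_of_nonneg (ladGS_nonneg p x) (by norm_num),
      ← ofReal_norm, ENNReal.ofReal_rpow_of_nonneg (by positivity) (by positivity)]
    norm_num
  simp only [e]
  rw [lintegral_const_mul' _ _ (by simp)]
  gcongr
  exact h2.trans (by gcongr)

lemma lad_real {a d x : ℝ} (ha : 0 ≤ a) (hd : 0 ≤ d) (hx : 0 ≤ x)
    (h : x ≤ (4 / 3 * ((a ^ (1 / 3 : ℝ) * x ^ (2 / 3 : ℝ)) ^ (1 / 2 : ℝ) * d ^ (1 / 2 : ℝ))) ^ (3 / 2 : ℝ)) :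
    x ^ (1 / 2 : ℝ) ≤ 2 * (a ^ (1 / 2 : ℝ)) ^ (1 / 2 : ℝ) * (d ^ (1 / 2 : ℝ)) ^ (3 / 2 : ℝ) := by
  rcases hx.eq_or_lt with rfl | hx0
  · rw [Real.zero_rpow (by norm_num)]; positivity
  have e : (4 / 3 * ((a ^ (1 / 3 : ℝ) * x ^ (2 / 3 : ℝ)) ^ (1 / 2 : ℝ) * d ^ (1 / 2 : ℝ))) ^ (3 / 2 : ℝ)
      = ((4 / 3 : ℝ) ^ (3 / 2 : ℝ) * (a ^ (1 / 2 : ℝ)) ^ (1 / 2 : ℝ) * (d ^ (1 / 2 : ℝ)) ^ (3 / 2 : ℝ))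
        * x ^ (1 / 2 : ℝ) := by
    rw [Real.mul_rpow (by positivity) (by positivity), Real.mul_rpow (by positivity) (by positivity),
      Real.mul_rpow (by positivity) (by positivity), Real.mul_rpow (by positivity) (by positivity)]
    simp only [← Real.rpow_mul ha, ← Real.rpow_mul hx, ← Real.rpow_mul hd]
    norm_num
    ring
  have e2 : x = x ^ (1 / 2 : ℝ) * x ^ (1 / 2 : ℝ) := by
    rw [← Real.rpow_add hx0]; norm_num
  rw [e] at h
  have hpos : 0 < x ^ (1 / 2 : ℝ) := by positivity
  have h2 : x ^ (1 / 2 : ℝ) * x ^ (1 / 2 : ℝ) ≤ _ := e2.symm.le.trans h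
  have h3 := le_of_mul_le_mul_right h2 hpos
  refine h3.trans ?_
  have h4 : (4 / 3 : ℝ) ^ (3 / 2 : ℝ) ≤ 2 := by
    calc (4 / 3 : ℝ) ^ (3 / 2 : ℝ) ≤ (4 / 3 : ℝ) ^ (2 : ℝ) :=
          Real.rpow_le_rpow_of_exponent_le (by norm_num) (by norm_num)
      _ ≤ 2 := by norm_num
  gcongr

lemma lad_pt (p q : LadE → LadE) (x : LadE) :
    ‖∑ j, (∑ i, p x i * fderiv ℝ q x (EuclideanSpace.single i 1) j) * p x j‖ₑ ≤
      (‖p x‖ₑ ^ (4 : ℝ)) ^ (1 / 2 : ℝ) * ENNReal.ofReal (ladGS q x) ^ (1 / 2 : ℝ) := by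
  have e : (‖p x‖ₑ ^ (4 : ℝ)) ^ (1 / 2 : ℝ) * ENNReal.ofReal (ladGS q x) ^ (1 / 2 : ℝ)
      = ENNReal.ofReal (‖p x‖ ^ 2 * √(ladGS q x)) := by
    rw [← ENNReal.rpow_mul, ENNReal.ofReal_mul (by positivity), Real.sqrt_eq_rpow,
      ENNReal.ofReal_rpow_of_nonneg (ladGS_nonneg q x) (by norm_num),
      ← ofReal_norm, ENNReal.ofReal_rpow_of_nonneg (by positivity) (by positivity)]
    norm_num
  rw [e, ← ofReal_norm, Real.norm_eq_abs]
  apply ENNReal.ofReal_le_ofReal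
  have e3 : ‖p x‖ ^ 2 * √(ladGS q x) = √((‖p x‖ ^ 2) ^ 2 * ladGS q x) := by
    rw [Real.sqrt_mul' _ (ladGS_nonneg q x), Real.sqrt_sq (by positivity)]
  rw [e3]
  apply Real.abs_le_sqrt
  rw [EuclideanSpace.norm_sq_eq]
  simp only [Real.norm_eq_abs, sq_abs]
  have h := Finset.sum_mul_sq_le_sq_mul_sq (Finset.univ : Finset (Fin 3 × Fin 3))
    (fun k => p x k.1 * p x k.2) (fun k => fderiv ℝ q x (EuclideanSpace.single k.1 1) k.2)
  rw [Fintype.sum_prod_type, Fintype.sum_prod_type, Fintype.sum_prod_type] at h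
  simp only [ladGS]
  refine le_trans (le_of_eq ?_) (h.trans (le_of_eq ?_))
  · simp only [Fin.sum_univ_three]; ring
  · simp only [Fin.sum_univ_three]; ring

theorem convection_trilinear_ladyzhenskaya_bound
    (p q : EuclideanSpace ℝ (Fin 3) → EuclideanSpace ℝ (Fin 3))
    (hp : ContDiff ℝ 1 p) (hps : HasCompactSupport p)
    (hq : Differentiable ℝ q)
    (hq2 : Integrable
      (fun x => ∑ i, ∑ j, (fderiv ℝ q x (EuclideanSpace.single i 1) j) ^ 2)) :
    |∫ x, ∑ j, (∑ i, p x i * fderiv ℝ q x (EuclideanSpace.single i 1) j) * p x j|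
      ≤ 2 * ((∫ x, ‖p x‖ ^ 2) ^ ((1 : ℝ) / 2)) ^ ((1 : ℝ) / 2)
          * ((∫ x, ∑ i, ∑ j, (fderiv ℝ p x (EuclideanSpace.single i 1) j) ^ 2)
              ^ ((1 : ℝ) / 2)) ^ ((3 : ℝ) / 2)
          * (∫ x, ∑ i, ∑ j, (fderiv ℝ q x (EuclideanSpace.single i 1) j) ^ 2)
              ^ ((1 : ℝ) / 2) := by
  change _ ≤ 2 * ((∫ x, ‖p x‖ ^ 2) ^ ((1 : ℝ) / 2)) ^ ((1 : ℝ) / 2)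
          * ((∫ x, ladGS p x) ^ ((1 : ℝ) / 2)) ^ ((3 : ℝ) / 2)
          * (∫ x, ladGS q x) ^ ((1 : ℝ) / 2)
  change Integrable (ladGS q) at hq2
  have hm := hp.continuous.measurable
  have hpow : ∀ n : ℕ, n ≠ 0 → Integrable (fun x => ‖p x‖ ^ n) := fun n hn =>
    (hp.continuous.norm.pow n).integrable_of_hasCompactSupport
      (hps.norm.comp_left (g := fun s : ℝ => s ^ n) (by simp [hn]))
  have hpe : ∀ n : ℕ, n ≠ 0 → ∫⁻ x, ‖p x‖ₑ ^ (n : ℝ) = ENNReal.ofReal (∫ x, ‖p x‖ ^ n) := by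
    intro n hn
    rw [ofReal_integral_eq_lintegral_ofReal (hpow n hn) (.of_forall fun x => by positivity)]
    congr with x
    rw [ENNReal.rpow_natCast, ENNReal.ofReal_pow (by positivity), ofReal_norm]
  have hgp : Integrable (ladGS p) := by
    have hfc := hp.continuous_fderiv one_ne_zero
    refine Continuous.integrable_of_hasCompactSupport ?_ ?_
    · unfold ladGS
      fun_prop
    · refine (hps.fderiv ℝ).mono' ?_
      intro x hx
      apply subset_tsupport
      intro h0
      apply hx
      simp [ladGS, h0]
  have hA := hpe 2 (by norm_num)
  have hX := hpe 4 (by norm_num)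
  norm_num only [Nat.cast_ofNat] at hA hX
  have hD := ofReal_integral_eq_lintegral_ofReal hgp (.of_forall (ladGS_nonneg p))
  have hQ := ofReal_integral_eq_lintegral_ofReal hq2 (.of_forall (ladGS_nonneg q))
  have a0 : 0 ≤ ∫ x, ‖p x‖ ^ 2 := integral_nonneg fun x => by positivity
  have x0 : 0 ≤ ∫ x, ‖p x‖ ^ 4 := integral_nonneg fun x => by positivity
  have d0 : 0 ≤ ∫ x, ladGS p x := integral_nonneg (ladGS_nonneg p)
  have q0 : 0 ≤ ∫ x, ladGS q x := integral_nonneg (ladGS_nonneg q)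
  have h1 := (lad_grid p hp hps).trans (ENNReal.rpow_le_rpow (lad_holder p hp) (by norm_num))
  rw [hA, hX, ← hD, ENNReal.ofReal_rpow_of_nonneg a0 (by norm_num),
    ENNReal.ofReal_rpow_of_nonneg x0 (by norm_num), ENNReal.ofReal_rpow_of_nonneg d0 (by norm_num),
    ← ENNReal.ofReal_mul (by positivity), ENNReal.ofReal_rpow_of_nonneg (by positivity) (by norm_num),
    ← ENNReal.ofReal_mul (by positivity), ← ENNReal.ofReal_mul (by positivity),
    ENNReal.ofReal_rpow_of_nonneg (by positivity) (by norm_num),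
    ENNReal.ofReal_le_ofReal_iff (by positivity)] at h1
  have h2 := lad_real a0 d0 x0 h1
  have h3 := ENNReal.lintegral_mul_norm_pow_le (μ := (volume : Measure LadE))
      (f := fun x => ‖p x‖ₑ ^ (4 : ℝ)) (g := fun x => ENNReal.ofReal (ladGS q x))
      (by fun_prop) (by have := ladGS_meas q; fun_prop)
      (p := 1 / 2) (q := 1 / 2) (by norm_num) (by norm_num) (by norm_num)
  have h4 := (enorm_integral_le_lintegral_enorm _).trans ((lintegral_mono (lad_pt p q)).trans h3)
  rw [hX, ← hQ, ENNReal.ofReal_rpow_of_nonneg x0 (by norm_num),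
    ENNReal.ofReal_rpow_of_nonneg q0 (by norm_num), ← ENNReal.ofReal_mul (by positivity),
    ← ofReal_norm, ENNReal.ofReal_le_ofReal_iff (by positivity), Real.norm_eq_abs] at h4
  exact h4.trans (mul_le_mul_of_nonneg_right h2 (by positivity))
end
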